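/- For every β ≥ 0 and h ∈ ℝ, the averaged constrained free energy converges: E^{(N)}[F^c_N(β,h,ω)] → G(β,h) as N → ∞, where G(β,h) := 0 if h ≤ −β; G(β,h) := F(h+β)/2 if −β < h < β; and G(β,h) := (F(h+β) + F(h−β))/2 if h ≥ β. -/

import Mathlib

open Filter Topology

/-- The contact point `t_i = s_1 + ⋯ + s_i` associated to interarrival times
`s : Fin k → {0,…,N}`. -/
def contacts {k N : ℕ} (s : Fin k → Fin (N + 1)) (i : Fin k) : ℕ :=
  ∑ j ∈ Finset.univ.filter (fun j => j ≤ i), (s j : ℕ)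

/-- The constrained homogeneous partition function `Z_{N,u}` (with `Z_{0,u} = 1`). -/
noncomputable def Zhom (K : ℕ → ℝ) (u : ℝ) (N : ℕ) : ℝ :=
  if N = 0 then 1 else
    ∑ k ∈ Finset.Icc 1 N, ∑ s : Fin k → Fin (N + 1),
      if (∀ i, 1 ≤ (s i : ℕ)) ∧ (∑ i, (s i : ℕ)) = N then
        Real.exp ((k : ℝ) * u) * ∏ i, K (s i : ℕ)
      else 0

/-- The quenched partition function `Z_{N,β,h,ω}`. -/
noncomputable def Zq (K : ℕ → ℝ) (β h : ℝ) (ω : ℕ → ℝ) (N : ℕ) : ℝ :=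
  ∑ k ∈ Finset.Icc 1 N, ∑ s : Fin k → Fin (N + 1),
    if (∀ i, 1 ≤ (s i : ℕ)) ∧ (∑ i, (s i : ℕ)) = N then
      Real.exp (∑ i : Fin k, (β * ω (contacts s i) + h)) * ∏ i, K (s i : ℕ)
    else 0

/-- The set of sign-change positions `m ∈ {2,…,N+1}` of `ω` (i.e. `ω_m ≠ ω_{m-1}`):
the strip endpoints `L_1 < ⋯ < L_{B_N}` are exactly these positions minus one. -/
noncomputable def changeSet (ω : ℕ → ℝ) (N : ℕ) : Finset ℕ :=
  (Finset.Icc 2 (N + 1)).filter fun m => ω m ≠ ω (m - 1)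

/-- `B_N`, the number of complete strips between `0` and `N`. -/
noncomputable def BN (ω : ℕ → ℝ) (N : ℕ) : ℕ := (changeSet ω N).card

/-- The strip endpoints: `L_0 = 0` and, for `1 ≤ k ≤ B_N`, `L_k` is the `k`-th
sign-change position of `ω` minus one. -/
noncomputable def Lstrip (ω : ℕ → ℝ) (N : ℕ) (k : ℕ) : ℕ :=
  if k = 0 then 0 else ((changeSet ω N).sort (· ≤ ·)).getD (k - 1) 0 - 1

/-- The constrained partition function `Z^c_{N,β,h,ω}`: the sum is restricted to
contact sets containing each of the strip endpoints `L_1, …, L_{B_N}`. -/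
noncomputable def Zc (K : ℕ → ℝ) (β h : ℝ) (ω : ℕ → ℝ) (N : ℕ) : ℝ :=
  ∑ k ∈ Finset.Icc 1 N, ∑ s : Fin k → Fin (N + 1),
    if (∀ i, 1 ≤ (s i : ℕ)) ∧ (∑ i, (s i : ℕ)) = N ∧
        (∀ m ∈ changeSet ω N, ∃ i : Fin k, contacts s i = m - 1) then
      Real.exp (∑ i : Fin k, (β * ω (contacts s i) + h)) * ∏ i, K (s i : ℕ)
    else 0

/-- The probability, under the stationary `{-1,+1}`-valued Markov chain `P^{(N)}`
with flip probability `N^{-γ}`, of the trajectory `w` on `{0,…,N+1}`. -/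
noncomputable def pathProb (γ : ℝ) (N : ℕ) (w : Fin (N + 2) → Bool) : ℝ :=
  (1 / 2) * ∏ i : Fin (N + 1),
    if w i.castSucc = w i.succ then 1 - (N : ℝ) ^ (-γ) else (N : ℝ) ^ (-γ)

/-- The `±1`-valued sequence associated to a trajectory `w` on `{0,…,N+1}`
(extended constantly beyond `N+1`; the partition functions at size `N` only
depend on the first `N+2` values). -/
noncomputable def omegaOf (N : ℕ) (w : Fin (N + 2) → Bool) (n : ℕ) : ℝ :=
  if hn : n < N + 2 then (if w ⟨n, hn⟩ then 1 else -1)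
  else (if w (Fin.last (N + 1)) then 1 else -1)

/-- The limiting free energy of model B:
`G(β,h) = 0` if `h ≤ -β`, `F(h+β)/2` if `-β < h < β`, and
`(F(h+β) + F(h-β))/2` if `h ≥ β`. -/
noncomputable def Gfun (F : ℝ → ℝ) (β h : ℝ) : ℝ :=
  if h ≤ -β then 0 else if h < β then F (h + β) / 2 else (F (h + β) + F (h - β)) / 2


open Classical in
/-- One-step weight. -/
noncomputable def wt (K V : ℕ → ℝ) (S : ℕ → Prop) (m n : ℕ) : ℝ :=
  if ∀ q, S q → m < q → n ≤ q then Real.exp (V n) * K (n - m) else 0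

/-- Partition function with exactly `k` contacts. -/
noncomputable def rk (K V : ℕ → ℝ) (S : ℕ → Prop) : ℕ → ℕ → ℝ
  | 0, n => if n = 0 then 1 else 0
  | k + 1, n => ∑ m ∈ Finset.range n, rk K V S k m * wt K V S m n

/-- Partition function. -/
noncomputable def RR (K V : ℕ → ℝ) (S : ℕ → Prop) (n : ℕ) : ℝ :=
  ∑ k ∈ Finset.range (n + 1), rk K V S k n

open Classical in
/-- Summand. -/
noncomputable def tm (K V : ℕ → ℝ) (S : ℕ → Prop) {k M : ℕ} (s : Fin k → Fin (M + 1)) (n : ℕ) : ℝ :=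
  if (∀ i, 1 ≤ (s i : ℕ)) ∧ (∑ i, (s i : ℕ)) = n ∧
        (∀ q, S q → 1 ≤ q → q ≤ n → ∃ i : Fin k, contacts s i = q) then
      Real.exp (∑ i : Fin k, V (contacts s i)) * ∏ i, K (s i : ℕ)
    else 0

lemma contacts_le {k M : ℕ} (s : Fin k → Fin (M + 1)) (i : Fin k) :
    contacts s i ≤ ∑ i, (s i : ℕ) := by
  unfold contacts
  exact Finset.sum_le_sum_of_subset (Finset.filter_subset _ _)

lemma contacts_snoc_castSucc {k M : ℕ} (s : Fin k → Fin (M + 1)) (a : Fin (M + 1)) (i : Fin k) :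
    contacts (Fin.snoc (α := fun _ => Fin (M + 1)) s a) i.castSucc = contacts s i := by
  unfold contacts
  rw [Finset.sum_filter, Finset.sum_filter, Fin.sum_univ_castSucc]
  have : ¬ (Fin.last k ≤ i.castSucc) := by
    simp [Fin.le_def]
  simp only [this, if_false, Fin.snoc_castSucc, Fin.castSucc_le_castSucc_iff, add_zero]

lemma contacts_snoc_last {k M : ℕ} (s : Fin k → Fin (M + 1)) (a : Fin (M + 1)) :
    contacts (Fin.snoc (α := fun _ => Fin (M + 1)) s a) (Fin.last k) = (∑ i, (s i : ℕ)) + a := by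
  unfold contacts
  rw [Finset.sum_filter, Fin.sum_univ_castSucc]
  simp [Fin.le_last]

lemma tm_snoc (K V : ℕ → ℝ) (S : ℕ → Prop) {k M : ℕ} (s : Fin k → Fin (M + 1)) (a : Fin (M + 1))
    (n : ℕ) :
    tm K V S (Fin.snoc (α := fun _ => Fin (M + 1)) s a) n =
      if 1 ≤ (a : ℕ) ∧ (a : ℕ) ≤ n then tm K V S s (n - a) * wt K V S (n - a) n else 0 := by
  classical
  unfold tm
  have e1 : ((∀ i, 1 ≤ (Fin.snoc (α := fun _ => Fin (M + 1)) s a i : ℕ)) ∧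
      (∑ i, (Fin.snoc (α := fun _ => Fin (M + 1)) s a i : ℕ)) = n ∧
        (∀ q, S q → 1 ≤ q → q ≤ n → ∃ i : Fin (k + 1),
          contacts (Fin.snoc (α := fun _ => Fin (M + 1)) s a) i = q)) ↔
      (((∀ i, 1 ≤ (s i : ℕ)) ∧ 1 ≤ (a : ℕ)) ∧ (∑ i, (s i : ℕ)) + a = n ∧
        (∀ q, S q → 1 ≤ q → q ≤ n → (∃ i : Fin k, contacts s i = q) ∨
          (∑ i, (s i : ℕ)) + a = q)) := by
    simp only [Fin.forall_fin_succ', Fin.exists_fin_succ', Fin.sum_univ_castSucc,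
      contacts_snoc_castSucc, contacts_snoc_last, Fin.snoc_castSucc, Fin.snoc_last]
  rw [if_congr e1 rfl rfl]
  simp only [Fin.sum_univ_castSucc,
    Fin.prod_univ_castSucc, contacts_snoc_castSucc, contacts_snoc_last, Fin.snoc_castSucc,
    Fin.snoc_last]
  by_cases ha : 1 ≤ (a : ℕ) ∧ (a : ℕ) ≤ n
  · rw [if_pos ha]
    obtain ⟨h1, h2⟩ := ha
    unfold wt
    by_cases hs : (∀ i, 1 ≤ (s i : ℕ)) ∧ (∑ i, (s i : ℕ)) = n - a
    · obtain ⟨hs1, hs2⟩ := hs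
      have hn : (∑ i, (s i : ℕ)) + a = n := by omega
      have hna : n - (n - a) = (a : ℕ) := by omega
      have hle : ∀ i, contacts s i ≤ n - a := fun i => hs2 ▸ contacts_le s i
      have key : (∀ q, S q → 1 ≤ q → q ≤ n → (∃ i : Fin k, contacts s i = q) ∨ n = q) ↔
        (∀ q, S q → 1 ≤ q → q ≤ n - a → ∃ i : Fin k, contacts s i = q) ∧
          (∀ q, S q → n - a < q → n ≤ q) := by
        constructor
        · intro H
          refine ⟨fun q hq h1q h2q => ?_, fun q hq h1q => ?_⟩
          · rcases H q hq h1q (by omega) with h | h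
            · exact h
            · omega
          · by_contra hc
            rcases H q hq (by omega) (by omega) with ⟨i, hi⟩ | h
            · have := hle i
              omega
            · omega
        · rintro ⟨H1, H2⟩ q hq h1q h2q
          by_cases hqa : q ≤ n - a
          · exact Or.inl (H1 q hq h1q hqa)
          · have := H2 q hq (by omega)
            right; omega
      rw [hn, hna]
      simp only [key, hs1, hs2, h1, implies_true, true_and]
      by_cases c1 : (∀ q, S q → 1 ≤ q → q ≤ n - a → ∃ i : Fin k, contacts s i = q)
      · by_cases c2 : (∀ q, S q → n - a < q → n ≤ q)
        · rw [if_pos ⟨c1, c2⟩, if_pos c1, if_pos c2, Real.exp_add]; ring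
        · rw [if_neg (fun h => c2 h.2), if_neg c2, mul_zero]
      · rw [if_neg (fun h => c1 h.1), if_neg c1, zero_mul]
    · rw [if_neg, if_neg, zero_mul]
      · exact fun h => hs ⟨h.1, h.2.1⟩
      · exact fun h => hs ⟨h.1.1, by have := h.2.1; omega⟩
  · rw [if_neg ha, if_neg]
    rintro ⟨⟨_, h1⟩, h2, _⟩
    exact ha ⟨h1, by omega⟩

lemma sum_tm (K V : ℕ → ℝ) (S : ℕ → Prop) (M : ℕ) : ∀ k n : ℕ, n ≤ M →
    ∑ s : Fin k → Fin (M + 1), tm K V S s n = rk K V S k n := by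
  intro k
  induction k with
  | zero =>
    intro n hn
    simp only [Finset.univ_unique, Finset.sum_singleton, tm, rk]
    by_cases h : n = 0
    · subst h
      rw [if_pos]
      · simp
      · refine ⟨fun i => i.elim0, by simp, fun q _ h1 h2 => by omega⟩
    · rw [if_neg, if_neg h]
      rintro ⟨_, h2, _⟩
      simp at h2; omega
  | succ k ih =>
    intro n hn
    rw [← (Fin.snocEquiv (fun _ => Fin (M + 1))).sum_comp, Fintype.sum_prod_type]
    have : ∀ a : Fin (M + 1), ∑ s : Fin k → Fin (M + 1),
        tm K V S (Fin.snocEquiv (fun _ => Fin (M + 1)) (a, s)) n =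
        (fun a : ℕ => if 1 ≤ a ∧ a ≤ n then rk K V S k (n - a) * wt K V S (n - a) n else 0) a := by
      intro a
      simp only [Fin.snocEquiv, Equiv.coe_fn_mk]
      have h2 := fun s => tm_snoc K V S (k := k) s a n
      rw [Finset.sum_congr rfl (fun s _ => h2 s)]
      by_cases ha : 1 ≤ (a : ℕ) ∧ (a : ℕ) ≤ n
      · simp only [if_pos ha]
        rw [← Finset.sum_mul, ih _ (by omega)]
      · simp [ha]
    rw [Finset.sum_congr rfl (fun a _ => this a)]
    rw [Fin.sum_univ_eq_sum_range (fun a : ℕ => if 1 ≤ a ∧ a ≤ n then rk K V S k (n - a) * wt K V S (n - a) n else 0)]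
    rw [rk, ← Finset.sum_filter]
    refine Finset.sum_nbij' (fun a => n - a) (fun m => n - m) ?_ ?_ ?_ ?_ ?_
    · intro a ha; simp at ha ⊢; omega
    · intro a ha; simp at ha ⊢; omega
    · intro a ha; simp at ha ⊢; omega
    · intro a ha; simp at ha ⊢; omega
    · intro a ha; rfl

lemma rk_zero_of_lt (K V : ℕ → ℝ) (S : ℕ → Prop) : ∀ k n : ℕ, n < k → rk K V S k n = 0 := by
  intro k
  induction k with
  | zero => intro n hn; omega
  | succ k ih =>
    intro n hn
    rw [rk]
    refine Finset.sum_eq_zero fun m hm => ?_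
    rw [ih m (by simp at hm; omega), zero_mul]

lemma RR_eq (K V : ℕ → ℝ) (S : ℕ → Prop) (n M : ℕ) (h : n ≤ M) :
    ∑ k ∈ Finset.range (M + 1), rk K V S k n = RR K V S n := by
  unfold RR
  symm
  refine Finset.sum_subset (by intro x; simp; omega) fun k _ hk => ?_
  exact rk_zero_of_lt _ _ _ _ _ (by simp at hk; omega)

lemma RR_zero (K V : ℕ → ℝ) (S : ℕ → Prop) : RR K V S 0 = 1 := by
  simp [RR, rk]

lemma RR_rec (K V : ℕ → ℝ) (S : ℕ → Prop) (n : ℕ) (hn : 1 ≤ n) :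
    RR K V S n = ∑ m ∈ Finset.range n, RR K V S m * wt K V S m n := by
  rw [RR, Finset.sum_range_succ']
  have : rk K V S 0 n = 0 := by simp [rk]; omega
  rw [this, add_zero]
  simp only [rk]
  rw [Finset.sum_comm]
  refine Finset.sum_congr rfl fun m hm => ?_
  rw [← Finset.sum_mul]
  congr 1
  obtain ⟨n, rfl⟩ : ∃ n', n = n' + 1 := ⟨n - 1, by omega⟩
  exact RR_eq _ _ _ _ _ (by simp at hm; omega)

lemma sum_Icc_tm (K V : ℕ → ℝ) (S : ℕ → Prop) (N : ℕ) (hN : 1 ≤ N) :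
    ∑ k ∈ Finset.Icc 1 N, ∑ s : Fin k → Fin (N + 1), tm K V S s N = RR K V S N := by
  rw [Finset.sum_congr rfl (fun k _ => sum_tm K V S N k N le_rfl), RR]
  refine Finset.sum_subset (by intro x; simp) fun k h1 h2 => ?_
  have : k = 0 := by simp at h1 h2; omega
  subst this
  simp [rk]; omega

lemma Zhom_eq (K : ℕ → ℝ) (u : ℝ) (N : ℕ) :
    Zhom K u N = RR K (fun _ => u) (fun _ => False) N := by
  unfold Zhom
  by_cases hN : N = 0
  · subst hN; simp [RR_zero]
  · rw [if_neg hN, ← sum_Icc_tm _ _ _ _ (by omega)]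
    simp [tm]

lemma Zc_eq (K : ℕ → ℝ) (β h : ℝ) (ω : ℕ → ℝ) (N : ℕ) (hN : 1 ≤ N) :
    Zc K β h ω N = RR K (fun n => β * ω n + h) (fun q => 1 ≤ q ∧ ω (q + 1) ≠ ω q) N := by
  classical
  unfold Zc
  rw [← sum_Icc_tm _ _ _ _ hN]
  refine Finset.sum_congr rfl fun k _ => Finset.sum_congr rfl fun s _ => ?_
  unfold tm
  have : (∀ m ∈ changeSet ω N, ∃ i : Fin k, contacts s i = m - 1) ↔
    (∀ q, (1 ≤ q ∧ ω (q + 1) ≠ ω q) → 1 ≤ q → q ≤ N → ∃ i : Fin k, contacts s i = q) := by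
    constructor
    · intro H q hq _ h2
      have := H (q + 1) (by simp [changeSet]; exact ⟨⟨by omega, by omega⟩, hq.2⟩)
      simpa using this
    · intro H m hm
      simp [changeSet] at hm
      obtain ⟨q, rfl⟩ : ∃ q, m = q + 1 := ⟨m - 1, by omega⟩
      simp at hm
      exact H q ⟨by omega, by simpa using hm.2⟩ (by omega) (by omega)
  exact if_congr (and_congr_right fun _ => and_congr_right fun _ => this) rfl rfl

lemma wt_nonneg (K V : ℕ → ℝ) (S : ℕ → Prop) (hK : ∀ n, 1 ≤ n → 0 < K n) (m n : ℕ) (h : m < n) :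
    0 ≤ wt K V S m n := by
  unfold wt
  split_ifs
  · exact mul_nonneg (Real.exp_nonneg _) (hK _ (by omega)).le
  · exact le_rfl

lemma RR_pos (K V : ℕ → ℝ) (S : ℕ → Prop) (hK : ∀ n, 1 ≤ n → 0 < K n) (n : ℕ) :
    0 < RR K V S n := by
  induction n using Nat.strong_induction_on with
  | _ n ih =>
    by_cases hn : n = 0
    · subst hn; simp [RR_zero]
    · rw [RR_rec _ _ _ _ (by omega)]
      refine Finset.sum_pos' (fun m hm => ?_) ⟨n - 1, by simp; omega, ?_⟩
      · simp at hm
        exact mul_nonneg (ih m hm).le (wt_nonneg _ _ _ hK _ _ hm)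
      · refine mul_pos (ih _ (by omega)) ?_
        rw [wt, if_pos (fun q _ h => by omega)]
        exact mul_pos (Real.exp_pos _) (hK _ (by omega))

/-- If the potential is constant `u` on `(p, p+j]`, no constraint strictly in `(p,p+j)`,
and `p` is a constraint (or 0), we factor. -/
lemma RR_factor (K V : ℕ → ℝ) (S : ℕ → Prop) (p : ℕ) (hp : p = 0 ∨ S p) (u : ℝ) : ∀ j,
    (∀ i, p < i → i ≤ p + j → V i = u) → (∀ i, p < i → i < p + j → ¬ S i) →
    RR K V S (p + j) = RR K V S p * RR K (fun _ => u) (fun _ => False) j := by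
  intro j
  induction j using Nat.strong_induction_on with
  | _ j ih =>
    intro hV hS
    by_cases hj : j = 0
    · subst hj; simp [RR_zero]
    rw [RR_rec _ _ _ _ (by omega), RR_rec _ _ _ j (by omega), Finset.mul_sum,
      Finset.sum_range_add]
    have h0 : ∑ m ∈ Finset.range p, RR K V S m * wt K V S m (p + j) = 0 := by
      refine Finset.sum_eq_zero fun m hm => ?_
      simp at hm
      rw [wt, if_neg, mul_zero]
      intro H
      rcases hp with hp | hp
      · omega
      · have := H p hp hm; omega
    rw [h0, zero_add]
    refine Finset.sum_congr rfl fun m hm => ?_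
    simp at hm
    rw [ih m hm (fun i h1 h2 => hV i h1 (by omega)) (fun i h1 h2 => hS i h1 (by omega)), mul_assoc]
    congr 2
    unfold wt
    rw [if_pos, if_pos, hV (p + j) (by omega) le_rfl]
    · congr 2; omega
    · simp
    · intro q hq h1
      by_contra hc
      exact hS q (by omega) (by omega) hq

lemma uniform_bound (K : ℕ → ℝ) (u Fu : ℝ)
    (hF : Tendsto (fun N : ℕ => Real.log (Zhom K u N) / N) atTop (𝓝 Fu)) (ε : ℝ) (hε : 0 < ε) :
    ∃ C : ℝ, 0 ≤ C ∧ ∀ j : ℕ, |Real.log (Zhom K u j) - j * Fu| ≤ ε * j + C := by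
  obtain ⟨j0, h0⟩ := Metric.tendsto_atTop.1 hF ε hε
  refine ⟨∑ j ∈ Finset.range (j0 + 1), |Real.log (Zhom K u j) - j * Fu|,
    Finset.sum_nonneg fun _ _ => abs_nonneg _, fun j => ?_⟩
  have hnn : 0 ≤ ∑ j ∈ Finset.range (j0 + 1), |Real.log (Zhom K u j) - j * Fu| :=
    Finset.sum_nonneg fun _ _ => abs_nonneg _
  by_cases hj : j < j0 + 1
  · have := Finset.single_le_sum (f := fun j : ℕ => |Real.log (Zhom K u j) - j * Fu|)
      (fun _ _ => abs_nonneg _) (Finset.mem_range.2 hj)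
    have h2 : 0 ≤ ε * j := by positivity
    linarith
  · have h1 := h0 j (by omega)
    rw [Real.dist_eq] at h1
    have hjp : (0 : ℝ) < j := by exact_mod_cast (by omega : 0 < j)
    have : Real.log (Zhom K u j) - j * Fu = j * (Real.log (Zhom K u j) / j - Fu) := by
      field_simp
    rw [this, abs_mul, abs_of_pos hjp]
    nlinarith

lemma strip_bound (K : ℕ → ℝ) (hK : ∀ n, 1 ≤ n → 0 < K n) (F : ℝ → ℝ) (g : ℝ → ℝ) (ω : ℕ → ℝ)
    (ε C : ℝ) (hC : 0 ≤ C)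
    (hb : ∀ n j : ℕ, |Real.log (Zhom K (g (ω n)) j) - j * F (g (ω n))| ≤ ε * j + C) (N : ℕ) :
    |Real.log (RR K (fun n => g (ω n)) (fun q => 1 ≤ q ∧ ω (q + 1) ≠ ω q) N)
      - ∑ n ∈ Finset.range N, F (g (ω (n + 1)))| ≤
      ε * N + C * ((∑ q ∈ Finset.range N, if ω (q + 1) ≠ ω q then (1 : ℝ) else 0) + 1) := by
  classical
  induction N using Nat.strong_induction_on with
  | _ N ih =>
    by_cases hN : N = 0
    · subst hN; simp [RR_zero]; exact hC
    set S : ℕ → Prop := fun q => 1 ≤ q ∧ ω (q + 1) ≠ ω q with hS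
    set V : ℕ → ℝ := fun n => g (ω n) with hV
    obtain ⟨p, hpN, hp, hlast⟩ : ∃ p, p < N ∧ (p = 0 ∨ S p) ∧ ∀ i, p < i → i < N → ¬ S i := by
      refine ⟨Nat.findGreatest (fun p => p = 0 ∨ S p) (N - 1), ?_, ?_, ?_⟩
      · have := Nat.findGreatest_le (P := fun p => p = 0 ∨ S p) (N - 1); omega
      · exact Nat.findGreatest_spec (P := fun p => p = 0 ∨ S p) (m := 0) (by omega) (Or.inl rfl)
      · intro i h1 h2 h3
        exact Nat.findGreatest_is_greatest h1 (by omega) (Or.inr h3)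
    obtain ⟨j, rfl⟩ : ∃ j, N = p + j := ⟨N - p, by omega⟩
    have hconst : ∀ i, i < j → ω (p + (i + 1)) = ω (p + 1) := by
      intro i
      induction i with
      | zero => intro _; rfl
      | succ i ih2 =>
        intro hi
        rw [← ih2 (by omega)]
        by_contra hc
        exact hlast (p + (i + 1)) (by omega) (by omega) ⟨by omega, hc⟩
    have hfac := RR_factor K V S p hp (g (ω (p + 1))) j
      (by
        intro i h1 h2
        obtain ⟨i, rfl⟩ : ∃ i', i = p + (i' + 1) := ⟨i - p - 1, by omega⟩
        simp only [hV]
        rw [hconst i (by omega)]) hlast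
    rw [hfac, ← Zhom_eq, Real.log_mul (RR_pos K V S hK p).ne' (by rw [Zhom_eq]; exact (RR_pos K _ _ hK j).ne'),
      Finset.sum_range_add]
    have hsum : ∑ x ∈ Finset.range j, F (g (ω (p + x + 1))) = j * F (g (ω (p + 1))) := by
      rw [Finset.sum_congr rfl (fun x hx => by
        rw [add_assoc, hconst x (by simpa using hx)])]
      simp
    rw [hsum]
    have hbj := hb (p + 1) j
    have htri : |Real.log (RR K V S p) + Real.log (Zhom K (g (ω (p + 1))) j) -
        (∑ x ∈ Finset.range p, F (g (ω (x + 1))) + j * F (g (ω (p + 1))))| ≤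
        |Real.log (RR K V S p) - ∑ x ∈ Finset.range p, F (g (ω (x + 1)))| +
        |Real.log (Zhom K (g (ω (p + 1))) j) - j * F (g (ω (p + 1)))| := by
      refine le_trans (le_of_eq ?_) (abs_add_le _ _)
      congr 1; ring
    refine htri.trans ?_
    rw [Finset.sum_range_add]
    have hnn : ∀ q, 0 ≤ (if ω (q + 1) ≠ ω q then (1 : ℝ) else 0) := by
      intro q; split_ifs <;> norm_num
    have hnn1 : 0 ≤ ∑ x ∈ Finset.range p, (if ω (x + 1) ≠ ω x then (1 : ℝ) else 0) :=
      Finset.sum_nonneg fun x _ => hnn x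
    have hnn2 : 0 ≤ ∑ x ∈ Finset.range j, (if ω (p + x + 1) ≠ ω (p + x) then (1 : ℝ) else 0) :=
      Finset.sum_nonneg fun x _ => hnn (p + x)
    push_cast
    by_cases hp0 : p = 0
    · subst hp0
      simp only [RR_zero, Finset.range_zero, Finset.sum_empty, Real.log_one] at *
      simp only [sub_zero, abs_zero, Nat.cast_zero]
      nlinarith [mul_nonneg hC hnn2]
    · have hSp : S p := by tauto
      have ihp := ih p (by omega)
      have h1 : 1 ≤ ∑ x ∈ Finset.range j, (if ω (p + x + 1) ≠ ω (p + x) then (1 : ℝ) else 0) := by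
        have := Finset.single_le_sum (f := fun x => if ω (p + x + 1) ≠ ω (p + x) then (1 : ℝ) else 0)
          (fun x _ => hnn (p + x)) (Finset.mem_range.2 (by omega : 0 < j))
        simp only [add_zero] at this
        rwa [if_pos hSp.2] at this
      nlinarith [mul_le_mul_of_nonneg_left h1 hC]

lemma F_zero (α : ℝ) (L K : ℕ → ℝ)
    (hL : ∀ c : ℝ, 0 < c →
      Tendsto (fun n : ℕ => L ⌊c * (n : ℝ)⌋₊ / L n) atTop (𝓝 1))
    (hKL : ∀ n : ℕ, 1 ≤ n → K n = L n * (n : ℝ) ^ (-(1 + α)))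
    (hKpos : ∀ n, 1 ≤ n → 0 < K n) (hKsum : ∑' n : ℕ, K (n + 1) = 1)
    (u Fu : ℝ) (hu : u ≤ 0)
    (hF : Tendsto (fun N : ℕ => Real.log (Zhom K u N) / N) atTop (𝓝 Fu)) : Fu = 0 := by
  have hsm : Summable fun n => K (n + 1) := by
    by_contra hc
    rw [tsum_eq_zero_of_not_summable hc] at hKsum
    norm_num at hKsum
  have hpart : ∀ n, ∑ m ∈ Finset.range n, K (n - m) ≤ 1 := by
    intro n
    rw [← Finset.sum_range_reflect, ← hKsum]
    refine le_trans (le_of_eq ?_) (hsm.sum_le_tsum (Finset.range n) (fun i _ => (hKpos _ (by omega)).le))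
    refine Finset.sum_congr rfl fun i hi => ?_
    simp at hi
    congr 1; omega
  have hwt : ∀ m n, wt K (fun _ => u) (fun _ => False) m n = Real.exp u * K (n - m) := by
    intro m n; simp [wt]
  have hle : ∀ n, RR K (fun _ => u) (fun _ => False) n ≤ 1 := by
    intro n
    induction n using Nat.strong_induction_on with
    | _ n ih =>
      by_cases hn : n = 0
      · subst hn; simp [RR_zero]
      · rw [RR_rec _ _ _ _ (by omega)]
        refine le_trans (Finset.sum_le_sum fun m hm => ?_) (hpart n)
        simp at hm
        rw [hwt]
        have hk := hKpos (n - m) (by omega)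
        have h1 := ih m hm
        have h0 := (RR_pos K (fun _ => u) (fun _ => False) hKpos m).le
        have he : Real.exp u ≤ 1 := Real.exp_le_one_iff.2 hu
        have he0 := Real.exp_pos u
        calc _ ≤ 1 * (1 * K (n - m)) := by gcongr
          _ = _ := by ring
  have hge : ∀ n, 1 ≤ n → Real.exp u * K n ≤ RR K (fun _ => u) (fun _ => False) n := by
    intro n hn
    rw [RR_rec _ _ _ _ hn]
    have := Finset.single_le_sum (f := fun m => RR K (fun _ => u) (fun _ => False) m *
      wt K (fun _ => u) (fun _ => False) m n) (s := Finset.range n) (fun m hm => by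
        simp at hm
        exact mul_nonneg (RR_pos _ _ _ hKpos m).le (wt_nonneg _ _ _ hKpos _ _ hm))
      (Finset.mem_range.2 (by omega : 0 < n))
    simpa [RR_zero, hwt] using this
  -- lower bound on L
  have hLpos : ∀ n, 1 ≤ n → 0 < L n := by
    intro n hn
    have h1 := hKpos n hn
    rw [hKL n hn] at h1
    have : 0 < (n : ℝ) ^ (-(1 + α)) := Real.rpow_pos_of_pos (by exact_mod_cast hn) _
    exact pos_of_mul_pos_left h1 this.le
  obtain ⟨c, hc, hLc⟩ : ∃ c : ℝ, 0 < c ∧ ∀ n : ℕ, 1 ≤ n → c ≤ L n * n := by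
    have h2 := (hL (1 / 2) (by norm_num)).eventually (gt_mem_nhds (show (1 : ℝ) < 2 by norm_num))
    obtain ⟨n0, h0⟩ := eventually_atTop.1 h2
    have hne : (Finset.Icc 1 (n0 + 2)).Nonempty := ⟨1, by simp⟩
    obtain ⟨a, ha, hmin⟩ := Finset.exists_min_image (Finset.Icc 1 (n0 + 2)) (fun n : ℕ => L n * n) hne
    simp at ha
    refine ⟨L a * a, mul_pos (hLpos a ha.1) (by exact_mod_cast ha.1), fun n => ?_⟩
    induction n using Nat.strong_induction_on with
    | _ n ih =>
      intro hn
      by_cases hs : n ≤ n0 + 2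
      · exact hmin n (by simp; omega)
      · have h3 := h0 n (by omega)
        have hfl : ⌊(1 / 2 : ℝ) * n⌋₊ = n / 2 := by
          rw [show (1 / 2 : ℝ) * n = (n : ℝ) / (2 : ℕ) by push_cast; ring, Nat.floor_div_natCast,
            Nat.floor_natCast]
        rw [hfl, div_lt_iff₀ (hLpos n hn)] at h3
        have h4 := ih (n / 2) (by omega) (by omega)
        have h5 : ((n / 2 : ℕ) : ℝ) ≤ (n : ℝ) / 2 := by
          exact_mod_cast Nat.cast_div_le
        have h6 : 0 ≤ ((n / 2 : ℕ) : ℝ) := by positivity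
        have h7 := hLpos n hn
        calc L a * a ≤ L (n / 2) * (n / 2 : ℕ) := h4
          _ ≤ (2 * L n) * ((n : ℝ) / 2) := by gcongr
          _ = L n * n := by ring
  have hKlow : ∀ n : ℕ, 1 ≤ n → u + Real.log c - (2 + α) * Real.log n ≤ Real.log (Zhom K u n) := by
    intro n hn
    have hnp : (0 : ℝ) < n := by exact_mod_cast hn
    have h1 : Real.exp (u + Real.log c - (2 + α) * Real.log n) ≤ Zhom K u n := by
      rw [Zhom_eq]
      refine le_trans ?_ (hge n hn)
      rw [add_sub_assoc, Real.exp_add]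
      gcongr
      rw [hKL n hn, Real.rpow_def_of_pos hnp, sub_eq_add_neg, Real.exp_add, Real.exp_log hc]
      have : -((2 + α) * Real.log n) = -Real.log n + Real.log n * -(1 + α) := by ring
      rw [this, Real.exp_add, ← mul_assoc]
      gcongr
      rw [Real.exp_neg, Real.exp_log hnp, ← div_eq_mul_inv, div_le_iff₀ hnp]
      exact hLc n hn
    have := Real.log_le_log (Real.exp_pos _) h1
    rwa [Real.log_exp] at this
  apply le_antisymm
  · refine le_of_tendsto hF (Eventually.of_forall fun n => ?_)
    refine div_nonpos_of_nonpos_of_nonneg (Real.log_nonpos ?_ ?_) (by positivity)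
    · rw [Zhom_eq]; exact (RR_pos _ _ _ hKpos n).le
    · rw [Zhom_eq]; exact hle n
  · have hlim : Tendsto (fun n : ℕ => (u + Real.log c) / n - (2 + α) * (Real.log n / n)) atTop (𝓝 0) := by
      have a1 : Tendsto (fun n : ℕ => (u + Real.log c) / (n : ℝ)) atTop (𝓝 0) :=
        tendsto_const_div_atTop_nhds_zero_nat _
      have a2 : Tendsto (fun n : ℕ => Real.log n / (n : ℝ)) atTop (𝓝 0) :=
        (Real.isLittleO_log_id_atTop.tendsto_div_nhds_zero).comp tendsto_natCast_atTop_atTop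
      simpa using a1.sub (a2.const_mul (2 + α))
    refine le_of_tendsto_of_tendsto hlim hF ?_
    filter_upwards [eventually_ge_atTop 1] with n hn
    have hnp : (0 : ℝ) < n := by exact_mod_cast hn
    have := hKlow n hn
    rw [show (u + Real.log c) / n - (2 + α) * (Real.log n / n) =
      (u + Real.log c - (2 + α) * Real.log n) / n by ring]
    gcongr

lemma chain_sum (c : ℕ → ℝ) (g : ℕ → Bool → Bool → ℝ)
    (hg : ∀ i a, g i a true + g i a false = c i) (n : ℕ) :
    ∑ w : Fin (n + 1) → Bool, ∏ i : Fin n, g i (w i.castSucc) (w i.succ) =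
      2 * ∏ i ∈ Finset.range n, c i := by
  induction n with
  | zero => simp
  | succ n ih =>
    rw [← (Fin.snocEquiv (fun _ => Bool)).sum_comp, Fintype.sum_prod_type, Finset.sum_comm,
      Finset.prod_range_succ, ← mul_assoc, ← ih, Finset.sum_mul]
    refine Finset.sum_congr rfl fun w _ => ?_
    rw [← hg n (w (Fin.last n))]
    simp only [Fin.snocEquiv, Equiv.coe_fn_mk, Fin.prod_univ_castSucc, Fintype.sum_bool]
    have h1 : ∀ (b : Bool) (i : Fin n),
      (Fin.snoc (α := fun _ => Bool) w b i.castSucc.succ : Bool) = w i.succ := by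
      intro b i
      rw [← Fin.castSucc_succ, Fin.snoc_castSucc]
    simp only [Fin.snoc_castSucc, h1, Fin.succ_last, Fin.snoc_last, Fin.val_castSucc, Fin.val_last]
    ring

lemma pathProb_sum (γ : ℝ) (N : ℕ) : ∑ w, pathProb γ N w = 1 := by
  unfold pathProb
  rw [← Finset.mul_sum]
  have := chain_sum (fun _ => 1) (fun _ a b => if a = b then 1 - (N : ℝ) ^ (-γ) else (N : ℝ) ^ (-γ))
    (by intro i a; cases a <;> simp) (N + 1)
  rw [this]; simp

lemma pathProb_flip (γ : ℝ) (N : ℕ) (j : Fin (N + 1)) :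
    ∑ w, pathProb γ N w * (if w j.succ ≠ w j.castSucc then (1 : ℝ) else 0) = (N : ℝ) ^ (-γ) := by
  have := chain_sum (fun i => if i = (j : ℕ) then (N : ℝ) ^ (-γ) else 1)
    (fun i a b => (if a = b then 1 - (N : ℝ) ^ (-γ) else (N : ℝ) ^ (-γ)) *
      (if i = (j : ℕ) then (if b ≠ a then 1 else 0) else 1))
    (by intro i a; by_cases h : i = (j : ℕ) <;> cases a <;> simp [h]) (N + 1)
  have hR : ∏ i ∈ Finset.range (N + 1), (if i = (j : ℕ) then (N : ℝ) ^ (-γ) else 1) = (N : ℝ) ^ (-γ) := by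
    rw [Finset.prod_ite_eq', if_pos (Finset.mem_range.2 j.2)]
  rw [hR] at this
  have h2 : ∀ w : Fin (N + 2) → Bool, pathProb γ N w * (if w j.succ ≠ w j.castSucc then (1 : ℝ) else 0)
      = (1 / 2) * ∏ i : Fin (N + 1), ((if w i.castSucc = w i.succ then 1 - (N : ℝ) ^ (-γ) else (N : ℝ) ^ (-γ)) *
      (if (i : ℕ) = (j : ℕ) then (if w i.succ ≠ w i.castSucc then 1 else 0) else 1)) := by
    intro w
    rw [Finset.prod_mul_distrib, pathProb]
    simp only [← Fin.ext_iff]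
    rw [Finset.prod_ite_eq', mul_assoc]
    simp
  simp only [h2]
  rw [← Finset.mul_sum, this]; ring

lemma pathProb_nonneg (γ : ℝ) (hγ : 0 < γ) (N : ℕ) (hN : 1 ≤ N) (w) : 0 ≤ pathProb γ N w := by
  unfold pathProb
  refine mul_nonneg (by norm_num) (Finset.prod_nonneg fun i _ => ?_)
  have h1 : (N : ℝ) ^ (-γ) ≤ 1 :=
    Real.rpow_le_one_of_one_le_of_nonpos (by exact_mod_cast hN) (by linarith)
  have h0 : 0 ≤ (N : ℝ) ^ (-γ) := by positivity
  split_ifs <;> linarith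

lemma pathProb_half (γ : ℝ) (N : ℕ) (f : Bool → ℝ) (j : Fin (N + 2)) :
    ∑ w, pathProb γ N w * f (w j) = (f true + f false) / 2 := by
  have h1 : ∑ w, pathProb γ N w * f (w j) = ∑ w, pathProb γ N w * f (!(w j)) := by
    let e : (Fin (N + 2) → Bool) ≃ (Fin (N + 2) → Bool) :=
      Equiv.piCongrRight (fun _ => Equiv.boolNot)
    rw [← e.sum_comp]
    refine Finset.sum_congr rfl fun w _ => ?_
    have : pathProb γ N (e w) = pathProb γ N w := by
      simp [pathProb, e]
    rw [this]
    simp [e]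
  have h2 : ∑ w, pathProb γ N w * f (w j) + ∑ w, pathProb γ N w * f (!(w j)) = f true + f false := by
    rw [← Finset.sum_add_distrib, ← one_mul (f true + f false), ← pathProb_sum γ N, Finset.sum_mul]
    refine Finset.sum_congr rfl fun w _ => ?_
    cases w j <;> simp <;> ring
  linarith

lemma omegaOf_lt (N : ℕ) (w : Fin (N + 2) → Bool) (j : Fin (N + 2)) :
    omegaOf N w j = if w j then 1 else -1 := by
  simp [omegaOf, j.2]

lemma omega_flip (N : ℕ) (w : Fin (N + 2) → Bool) (j : Fin (N + 1)) :
    (if omegaOf N w (j + 1) ≠ omegaOf N w j then (1 : ℝ) else 0) =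
      if w j.succ ≠ w j.castSucc then (1 : ℝ) else 0 := by
  have h1 := omegaOf_lt N w j.succ
  have h2 := omegaOf_lt N w j.castSucc
  simp only [Fin.val_succ, Fin.val_castSucc] at h1 h2
  rw [h1, h2]
  cases w j.succ <;> cases w j.castSucc <;> norm_num

theorem statement10 (α : ℝ) (hα : 0 ≤ α) (L K : ℕ → ℝ)
    (hL : ∀ c : ℝ, 0 < c →
      Tendsto (fun n : ℕ => L ⌊c * (n : ℝ)⌋₊ / L n) atTop (𝓝 1))
    (hKL : ∀ n : ℕ, 1 ≤ n → K n = L n * (n : ℝ) ^ (-(1 + α)))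
    (hKpos : ∀ n, 1 ≤ n → 0 < K n) (hKsum : ∑' n : ℕ, K (n + 1) = 1)
    (γ : ℝ) (hγ0 : 0 < γ) (hγ1 : γ < 1)
    (F : ℝ → ℝ)
    (hF : ∀ u : ℝ, Tendsto (fun N : ℕ => Real.log (Zhom K u N) / N) atTop (𝓝 (F u)))
    (β h : ℝ) (hβ : 0 ≤ β) :
    Tendsto (fun N : ℕ => ∑ w : Fin (N + 2) → Bool,
        pathProb γ N w * (Real.log (Zc K β h (omegaOf N w) N) / N))
      atTop (𝓝 (Gfun F β h)) := by
  have hF0 : ∀ u ≤ 0, F u = 0 := fun u hu =>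
    F_zero α L K hL hKL hKpos hKsum u (F u) hu (hF u)
  have hG : Gfun F β h = (F (h + β) + F (h - β)) / 2 := by
    unfold Gfun
    split_ifs with h1 h2
    · rw [hF0 (h + β) (by linarith), hF0 (h - β) (by linarith)]; norm_num
    · rw [hF0 (h - β) (by linarith)]; norm_num
    · rfl
  rw [hG]
  have hbound : ∀ ε : ℝ, 0 < ε → ∃ C : ℝ, 0 ≤ C ∧ ∀ N : ℕ, 1 ≤ N →
      |∑ w : Fin (N + 2) → Bool, pathProb γ N w * (Real.log (Zc K β h (omegaOf N w) N) / N) -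
        (F (h + β) + F (h - β)) / 2| ≤ ε + C * ((N : ℝ) ^ (-γ) + 1 / N) := by
    intro ε hε
    obtain ⟨C1, hC1, hb1⟩ := uniform_bound K (h + β) _ (hF _) ε hε
    obtain ⟨C2, hC2, hb2⟩ := uniform_bound K (h - β) _ (hF _) ε hε
    refine ⟨max C1 C2, le_max_of_le_left hC1, fun N hN => ?_⟩
    have hNp : (0 : ℝ) < N := by exact_mod_cast hN
    set C := max C1 C2
    have hC : 0 ≤ C := le_max_of_le_left hC1
    have hpt : ∀ w : Fin (N + 2) → Bool,
        |Real.log (Zc K β h (omegaOf N w) N) -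
          ∑ n ∈ Finset.range N, F (β * omegaOf N w (n + 1) + h)| ≤
        ε * N + C * ((∑ q ∈ Finset.range N,
          if omegaOf N w (q + 1) ≠ omegaOf N w q then (1 : ℝ) else 0) + 1) := by
      intro w
      rw [Zc_eq _ _ _ _ _ hN]
      refine strip_bound K hKpos F (fun x => β * x + h) (omegaOf N w) ε C hC ?_ N
      intro n j
      have : omegaOf N w n = 1 ∨ omegaOf N w n = -1 := by
        unfold omegaOf; split_ifs <;> simp
      rcases this with h1 | h1
      · simp only [h1]
        rw [show β * 1 + h = h + β by ring]
        exact (hb1 j).trans (by gcongr; exact le_max_left _ _)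
      · simp only [h1]
        rw [show β * -1 + h = h - β by ring]
        exact (hb2 j).trans (by gcongr; exact le_max_right _ _)
    have hmean : ∑ w : Fin (N + 2) → Bool, pathProb γ N w *
        (∑ n ∈ Finset.range N, F (β * omegaOf N w (n + 1) + h)) =
        N * ((F (h + β) + F (h - β)) / 2) := by
      simp only [Finset.mul_sum]
      rw [Finset.sum_comm]
      have : ∀ n ∈ Finset.range N, ∑ w : Fin (N + 2) → Bool,
          pathProb γ N w * F (β * omegaOf N w (n + 1) + h) = (F (h + β) + F (h - β)) / 2 := by
        intro n hn
        simp at hn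
        have h1 := pathProb_half γ N (fun b => F (β * (if b then 1 else -1) + h))
          ⟨n + 1, by omega⟩
        have h2 : ∀ w : Fin (N + 2) → Bool, omegaOf N w (n + 1) =
          if w ⟨n + 1, by omega⟩ then 1 else -1 := fun w => omegaOf_lt N w ⟨n + 1, by omega⟩
        simp only [h2]
        rw [h1]
        simp only [if_true, Bool.false_eq_true, if_false]
        rw [show β * 1 + h = h + β by ring, show β * -1 + h = h - β by ring]
      rw [Finset.sum_congr rfl this]
      simp
    have hflip : ∑ w : Fin (N + 2) → Bool, pathProb γ N w *
        (∑ q ∈ Finset.range N, if omegaOf N w (q + 1) ≠ omegaOf N w q then (1 : ℝ) else 0) =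
        N * (N : ℝ) ^ (-γ) := by
      simp only [Finset.mul_sum]
      rw [Finset.sum_comm]
      have : ∀ n ∈ Finset.range N, ∑ w : Fin (N + 2) → Bool,
          pathProb γ N w * (if omegaOf N w (n + 1) ≠ omegaOf N w n then (1 : ℝ) else 0) =
            (N : ℝ) ^ (-γ) := by
        intro n hn
        simp only [Finset.mem_range] at hn
        rw [← pathProb_flip γ N ⟨n, by omega⟩]
        refine Finset.sum_congr rfl fun w _ => ?_
        rw [← omega_flip N w ⟨n, by omega⟩]
      rw [Finset.sum_congr rfl this]
      simp
    have hsub : ∑ w : Fin (N + 2) → Bool,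
        pathProb γ N w * (Real.log (Zc K β h (omegaOf N w) N) / N) -
        (F (h + β) + F (h - β)) / 2 =
        (∑ w : Fin (N + 2) → Bool, pathProb γ N w * (Real.log (Zc K β h (omegaOf N w) N) -
          ∑ n ∈ Finset.range N, F (β * omegaOf N w (n + 1) + h))) / N := by
      simp only [mul_sub]
      rw [Finset.sum_sub_distrib, hmean, sub_div, Finset.sum_div]
      congr 1
      · exact Finset.sum_congr rfl fun w _ => by ring
      · field_simp
    rw [hsub, abs_div, abs_of_pos hNp, div_le_iff₀ hNp]
    calc _ ≤ ∑ w : Fin (N + 2) → Bool, pathProb γ N w * (ε * N + C * ((∑ q ∈ Finset.range N,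
          if omegaOf N w (q + 1) ≠ omegaOf N w q then (1 : ℝ) else 0) + 1)) := by
          refine (Finset.abs_sum_le_sum_abs _ _).trans (Finset.sum_le_sum fun w _ => ?_)
          have hp := pathProb_nonneg γ hγ0 N hN w
          rw [abs_mul, abs_of_nonneg hp]
          exact mul_le_mul_of_nonneg_left (hpt w) hp
      _ = (ε * N + C) * ∑ w : Fin (N + 2) → Bool, pathProb γ N w +
          C * ∑ w : Fin (N + 2) → Bool, pathProb γ N w *
        (∑ q ∈ Finset.range N, if omegaOf N w (q + 1) ≠ omegaOf N w q then (1 : ℝ) else 0) := by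
          rw [Finset.mul_sum, Finset.mul_sum, ← Finset.sum_add_distrib]
          exact Finset.sum_congr rfl fun w _ => by ring
      _ = (ε + C * ((N : ℝ) ^ (-γ) + 1 / N)) * N := by
          rw [hflip, pathProb_sum]
          field_simp
          ring
      _ ≤ _ := le_rfl
  rw [Metric.tendsto_atTop]
  intro ε hε
  obtain ⟨C, hC, hb⟩ := hbound (ε / 2) (by linarith)
  have hlim : Tendsto (fun N : ℕ => C * ((N : ℝ) ^ (-γ) + 1 / N)) atTop (𝓝 0) := by
    have a1 : Tendsto (fun N : ℕ => (N : ℝ) ^ (-γ)) atTop (𝓝 0) :=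
      (tendsto_rpow_neg_atTop hγ0).comp tendsto_natCast_atTop_atTop
    have a2 : Tendsto (fun N : ℕ => 1 / (N : ℝ)) atTop (𝓝 0) :=
      tendsto_const_div_atTop_nhds_zero_nat _
    simpa using (a1.add a2).const_mul C
  obtain ⟨n0, h0⟩ := eventually_atTop.1
    (hlim.eventually (gt_mem_nhds (show (0 : ℝ) < ε / 2 by linarith)))
  refine ⟨n0 + 1, fun N hN => ?_⟩
  rw [Real.dist_eq]
  have h1 := hb N (by omega)
  have h2 := h0 N (by omega)
  linarith
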